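/- Let Y be a ℤ-module and Q : Y → ℤ a quadratic map. Let v, w ∈ Y and f, g : Y → ℤ be ℤ-linear maps with f(v) = 2 and g(w) = 2, and suppose Q is invariant under both reflections y ↦ y − f(y) • v and y ↦ y − g(y) • w. Then Q(v) · f(w) = Q(w) · g(v). (In root-datum notation: Q(φ∨)⟨φ, ψ∨⟩ = Q(ψ∨)⟨ψ, φ∨⟩ for any two roots φ, ψ and any Weyl-invariant quadratic form Q; it follows from the symmetry of the polar form B_Q together with the identity B_Q(v, y) = Q(v)·f(y).) -/

import Mathlib

/-- The polar form `B_Q(y₁, y₂) = Q(y₁ + y₂) − Q(y₁) − Q(y₂)` of a map `Q : Y → ℤ`. -/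
def polarForm {Y : Type*} [AddCommGroup Y] (Q : Y → ℤ) (y₁ y₂ : Y) : ℤ :=
  Q (y₁ + y₂) - Q y₁ - Q y₂

/-- `Q : Y → ℤ` is a quadratic map: `Q(k • y) = k² Q(y)` and the polar form is
additive (hence, by symmetry, ℤ-bilinear). -/
def IsQuadraticMap {Y : Type*} [AddCommGroup Y] (Q : Y → ℤ) : Prop :=
  (∀ (k : ℤ) (y : Y), Q (k • y) = k ^ 2 * Q y) ∧
  (∀ y₁ y₂ y₃ : Y, polarForm Q (y₁ + y₂) y₃ = polarForm Q y₁ y₃ + polarForm Q y₂ y₃)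

theorem polarForm_comm {Y : Type*} [AddCommGroup Y] (Q : Y → ℤ) (x y : Y) :
    polarForm Q x y = polarForm Q y x := by
  rw [polarForm, polarForm, add_comm x y]
  ring

namespace IsQuadraticMap

variable {Y : Type*} [AddCommGroup Y] {Q : Y → ℤ}

theorem polarForm_zsmul_left (hQ : IsQuadraticMap Q) (k : ℤ) (x y : Y) :
    polarForm Q (k • x) y = k * polarForm Q x y := by
  simpa using map_zsmul (AddMonoidHom.mk' (fun z => polarForm Q z y) (hQ.2 · · y)) k x

theorem polarForm_self (hQ : IsQuadraticMap Q) (x : Y) : polarForm Q x x = 2 * Q x := by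
  rw [polarForm, ← two_zsmul, hQ.1]
  ring

/-- If `Q` is invariant under the reflection `y ↦ y - f y • v`, then `B_Q(v, y) = Q(v) f(y)`. -/
theorem polarForm_eq_mul_of_reflection_invariant (hQ : IsQuadraticMap Q) {v : Y}
    {f : Y →ₗ[ℤ] ℤ} (hfv : f v = 2) (hinv : ∀ y : Y, Q (y - f y • v) = Q y) (y : Y) :
    polarForm Q v y = Q v * f y := by
  have of_ne_zero (z : Y) (hz : f z ≠ 0) : polarForm Q v z = Q v * f z := by
    have h := hQ.polarForm_zsmul_left (-f z) v z
    rw [polarForm, neg_smul, neg_add_eq_sub, hinv, ← neg_smul, hQ.1] at h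
    apply mul_left_cancel₀ hz
    linarith
  by_cases hy : f y = 0
  · have h := of_ne_zero (v + y) (by simp [hfv, hy])
    rw [polarForm_comm, hQ.2, hQ.polarForm_self, map_add, hfv, polarForm_comm Q y v] at h
    linarith
  · exact of_ne_zero y hy

end IsQuadraticMap

/-- For two coroot–root pairs `(v, f)` and `(w, g)` whose reflections preserve the
quadratic map `Q`, one has `Q(v)·f(w) = Q(w)·g(v)`; i.e.
`Q(φ∨)⟨φ, ψ∨⟩ = Q(ψ∨)⟨ψ, φ∨⟩`. -/
theorem quadratic_cartan_symmetry {Y : Type*} [AddCommGroup Y]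
    (Q : Y → ℤ) (hQ : IsQuadraticMap Q)
    (v w : Y) (f g : Y →ₗ[ℤ] ℤ) (hfv : f v = 2) (hgw : g w = 2)
    (hinvf : ∀ y : Y, Q (y - f y • v) = Q y)
    (hinvg : ∀ y : Y, Q (y - g y • w) = Q y) :
    Q v * f w = Q w * g v := by
  rw [← hQ.polarForm_eq_mul_of_reflection_invariant hfv hinvf w,
    ← hQ.polarForm_eq_mul_of_reflection_invariant hgw hinvg v, polarForm_comm]
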